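/- Suppose {q_n} is a sequence of positive reals with β = lim_{n→∞} n(1−q_n) ∈ ℝ, and {a_n} is a sequence with a_n ∈ {1,…,n} and lim_{n→∞} a_n/n = a ∈ [0,1]. Suppose {a_{t_n}} is a subsequence such that the laws of π(a_{t_n})/t_n under μ_{t_n, q_{t_n}} converge in distribution to a probability measure v with distribution function F_v. Then F_v(y) = ∫_0^y u(a,t,β) dt for all y ∈ [0,1]. -/

import Mathlib

open Filter Finset MeasureTheory

/-- Number of inversions of a permutation of `Fin n`. -/
def inversions (n : ℕ) (π : Equiv.Perm (Fin n)) : ℕ :=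
  (Finset.univ.filter (fun p : Fin n × Fin n => p.1 < p.2 ∧ π p.2 < π p.1)).card

/-- The `(n,q)`-Mallows probability mass function on `S_n`. -/
noncomputable def mallowsPMF (n : ℕ) (q : ℝ) (π : Equiv.Perm (Fin n)) : ℝ :=
  q ^ inversions n π / ∑ σ : Equiv.Perm (Fin n), q ^ inversions n σ

open Classical in
/-- The `(n,q)`-Mallows probability of an event `P` of permutations. -/
noncomputable def mallowsProb (n : ℕ) (q : ℝ) (P : Equiv.Perm (Fin n) → Prop) : ℝ :=
  ∑ π : Equiv.Perm (Fin n), if P π then mallowsPMF n q π else 0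

/-- Expectation with respect to the `(n,q)`-Mallows measure. -/
noncomputable def mallowsExp (n : ℕ) (q : ℝ) (f : Equiv.Perm (Fin n) → ℝ) : ℝ :=
  ∑ π : Equiv.Perm (Fin n), mallowsPMF n q π * f π

/-- Action of a permutation of `Fin n` on one-based indices `{1,…,n}`. -/
def permAct (n : ℕ) (π : Equiv.Perm (Fin n)) (i : ℕ) : ℕ :=
  if h : 1 ≤ i ∧ i ≤ n then ((π ⟨i - 1, by omega⟩ : Fin n) : ℕ) + 1 else i

/-- The limiting density `u(x,y,β)` from Starr's theorem. -/
noncomputable def mallowsU (x y β : ℝ) : ℝ :=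
  if β = 0 then 1
  else (β / 2) * Real.sinh (β / 2) /
    (Real.exp (β / 4) * Real.cosh (β * (x - y) / 2)
      - Real.exp (-β / 4) * Real.cosh (β * (x + y - 1) / 2)) ^ 2

/-- The permutation sending `0` to `k` and acting on the remaining points in the same relative
order as `σ`. -/
def permInsert {n : ℕ} (k : Fin (n + 1)) (σ : Equiv.Perm (Fin n)) : Equiv.Perm (Fin (n + 1)) :=
  ((finSuccEquiv' 0).trans (Equiv.optionCongr σ)).trans (finSuccEquiv' k).symm

lemma permInsert_zero {n : ℕ} (k : Fin (n + 1)) (σ : Equiv.Perm (Fin n)) :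
    permInsert k σ 0 = k := by
  simp [permInsert]

lemma permInsert_succ {n : ℕ} (k : Fin (n + 1)) (σ : Equiv.Perm (Fin n)) (i : Fin n) :
    permInsert k σ i.succ = k.succAbove (σ i) := by
  have h : (finSuccEquiv' (0 : Fin (n + 1))) i.succ = some i := by
    rw [← Fin.succAbove_zero_apply, finSuccEquiv'_succAbove]
  simp [permInsert, h]

lemma permInsert_bijective (n : ℕ) :
    Function.Bijective
      (fun p : Fin (n + 1) × Equiv.Perm (Fin n) => permInsert p.1 p.2) := by
  rw [Fintype.bijective_iff_injective_and_card]
  constructor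
  · rintro ⟨k, σ⟩ ⟨l, τ⟩ h
    have hk : k = l := by
      have := congrArg (fun π => π 0) h
      simpa [permInsert_zero] using this
    subst hk
    have hσ : σ = τ := by
      ext i
      have := congrArg (fun π => π i.succ) h
      simp only [permInsert_succ] at this
      rw [Fin.succAbove_right_injective this]
    rw [hσ]
  · simp [Fintype.card_perm, Nat.factorial_succ]

lemma sum_perm_succ {n : ℕ} (f : Equiv.Perm (Fin (n + 1)) → ℝ) :
    ∑ π, f π = ∑ k, ∑ σ, f (permInsert k σ) := by
  rw [← Fintype.sum_prod_type' (fun k σ => f (permInsert k σ))]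
  exact ((permInsert_bijective n).sum_comp f).symm

lemma inversions_eq_sum (n : ℕ) (π : Equiv.Perm (Fin n)) :
    inversions n π = ∑ a, ∑ b, if a < b ∧ π b < π a then 1 else 0 := by
  rw [inversions, Finset.card_filter, Fintype.sum_prod_type]

lemma inversions_permInsert {n : ℕ} (k : Fin (n + 1)) (σ : Equiv.Perm (Fin n)) :
    inversions (n + 1) (permInsert k σ) = k + inversions n σ := by
  have hk : (∑ b : Fin n, if k.succAbove (σ b) < k then 1 else 0) = (k : ℕ) := by
    rw [Equiv.sum_comp σ (fun m => if k.succAbove m < k then 1 else 0)]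
    simp only [Fin.succAbove_lt_iff_castSucc_lt]
    simp only [Fin.lt_def, Fin.val_castSucc]
    rw [Fin.sum_univ_eq_sum_range (fun m => if m < (k : ℕ) then 1 else 0) n,
      ← Finset.sum_filter]
    have : (Finset.range n).filter (fun m => m < (k : ℕ)) = Finset.range k := by
      ext m
      have := k.is_lt
      simp only [Finset.mem_filter, Finset.mem_range]
      omega
    simp [this]
  rw [inversions_eq_sum, inversions_eq_sum, Fin.sum_univ_succ, Fin.sum_univ_succ]
  simp only [Fin.sum_univ_succ (n := n), permInsert_zero, permInsert_succ, Fin.succ_lt_succ_iff,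
    Fin.succAbove_lt_succAbove_iff, Fin.succ_pos, Fin.not_lt_zero, lt_irrefl, true_and, false_and,
    if_false, zero_add, hk]

/-- The `q`-integer `[k] = 1 + q + ⋯ + q ^ (k - 1)`. -/
def qInt (q : ℝ) (k : ℕ) : ℝ := ∑ m ∈ Finset.range k, q ^ m

lemma qInt_zero (q : ℝ) : qInt q 0 = 0 := by simp [qInt]

lemma qInt_succ (q : ℝ) (k : ℕ) : qInt q (k + 1) = 1 + q * qInt q k := by
  simp [qInt, Finset.sum_range_succ', Finset.mul_sum, pow_succ', add_comm]

lemma one_sub_mul_qInt (q : ℝ) (k : ℕ) : (1 - q) * qInt q k = 1 - q ^ k :=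
  mul_neg_geom_sum q k

lemma qInt_mono {q : ℝ} (hq : 0 < q) {k l : ℕ} (h : k ≤ l) : qInt q k ≤ qInt q l :=
  Finset.sum_le_sum_of_subset_of_nonneg (Finset.range_subset_range.2 h)
    (fun _ _ _ => by positivity)

lemma qInt_nonneg {q : ℝ} (hq : 0 < q) (k : ℕ) : 0 ≤ qInt q k :=
  Finset.sum_nonneg (fun _ _ => by positivity)

lemma qInt_pos {q : ℝ} (hq : 0 < q) (k : ℕ) : 0 < qInt q (k + 1) := by
  rw [qInt_succ]
  have := qInt_nonneg hq k
  positivity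

lemma sum_fin_ite_pow (q : ℝ) {n j : ℕ} (hj : j ≤ n) (x y : ℝ) :
    (∑ k : Fin n, q ^ (k : ℕ) * (if (k : ℕ) < j then x else y))
      = qInt q j * x + (qInt q n - qInt q j) * y := by
  rw [Fin.sum_univ_eq_sum_range (fun k => q ^ k * (if k < j then x else y)) n]
  obtain ⟨m, rfl⟩ := Nat.exists_eq_add_of_le hj
  have h : qInt q (j + m) - qInt q j = ∑ k ∈ Finset.range m, q ^ (j + k) := by
    rw [qInt, qInt, Finset.sum_range_add]
    ring
  rw [h, Finset.sum_range_add, qInt, Finset.sum_mul, Finset.sum_mul]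
  congr 1
  · refine Finset.sum_congr rfl fun k hk => ?_
    rw [if_pos (Finset.mem_range.1 hk)]
  · refine Finset.sum_congr rfl fun k _ => ?_
    rw [if_neg (by omega)]

lemma partition_pos {q : ℝ} (hq : 0 < q) (n : ℕ) :
    0 < ∑ σ : Equiv.Perm (Fin n), q ^ inversions n σ :=
  Finset.sum_pos (fun _ _ => by positivity) Finset.univ_nonempty

lemma partition_succ (q : ℝ) (n : ℕ) :
    ∑ σ : Equiv.Perm (Fin (n + 1)), q ^ inversions (n + 1) σ
      = qInt q (n + 1) * ∑ σ : Equiv.Perm (Fin n), q ^ inversions n σ := by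
  rw [sum_perm_succ]
  simp only [inversions_permInsert, pow_add, ← Finset.mul_sum, ← Finset.sum_mul]
  rw [Fin.sum_univ_eq_sum_range (fun k => q ^ k) (n + 1), qInt]

lemma mallowsExp_eq (n : ℕ) (q : ℝ) (f : Equiv.Perm (Fin n) → ℝ) :
    mallowsExp n q f
      = (∑ π, q ^ inversions n π * f π) / ∑ σ : Equiv.Perm (Fin n), q ^ inversions n σ := by
  simp only [mallowsExp, mallowsPMF, Finset.sum_div]
  exact Finset.sum_congr rfl fun π _ => by ring

/-- Sampling a Mallows permutation by first sampling the image of `0`. -/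
lemma mallowsExp_succ (q : ℝ) (n : ℕ) (f : Equiv.Perm (Fin (n + 1)) → ℝ) :
    mallowsExp (n + 1) q f
      = (∑ k : Fin (n + 1), q ^ (k : ℕ) * mallowsExp n q (fun σ => f (permInsert k σ)))
        / qInt q (n + 1) := by
  rw [mallowsExp_eq, partition_succ]
  simp only [mallowsExp_eq, sum_perm_succ, inversions_permInsert, pow_add,
    mul_assoc, ← Finset.mul_sum, mul_div_assoc', ← Finset.sum_div]
  rw [div_div, mul_comm (qInt q (n + 1))]

lemma mallowsExp_mono {q : ℝ} (hq : 0 < q) {n : ℕ} {f g : Equiv.Perm (Fin n) → ℝ}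
    (h : ∀ π, f π ≤ g π) : mallowsExp n q f ≤ mallowsExp n q g := by
  have hZ := partition_pos hq n
  refine Finset.sum_le_sum fun π _ => mul_le_mul_of_nonneg_left (h π) ?_
  unfold mallowsPMF
  positivity

lemma mallowsExp_const {q : ℝ} (hq : 0 < q) (n : ℕ) (c : ℝ) :
    mallowsExp n q (fun _ => c) = c := by
  rw [mallowsExp_eq, ← Finset.sum_mul, mul_div_cancel_left₀ _ (partition_pos hq n).ne']

/-- The Mallows probability that the image of `i` (zero-based) is less than `j`. -/
noncomputable def mallowsCDF (q : ℝ) (n : ℕ) (i : Fin n) (j : ℕ) : ℝ :=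
  mallowsExp n q (fun π => if (π i : ℕ) < j then 1 else 0)

lemma mallowsCDF_of_le {q : ℝ} (hq : 0 < q) {n : ℕ} (i : Fin n) {j : ℕ} (hj : n ≤ j) :
    mallowsCDF q n i j = 1 := by
  have : ∀ π : Equiv.Perm (Fin n), (π i : ℕ) < j := fun π => (π i).is_lt.trans_le hj
  simp only [mallowsCDF, this, if_true, mallowsExp_const hq]

lemma mallowsCDF_zero_right {q : ℝ} (hq : 0 < q) {n : ℕ} (i : Fin n) :
    mallowsCDF q n i 0 = 0 := by
  simp only [mallowsCDF, Nat.not_lt_zero, if_false, mallowsExp_const hq]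

lemma mallowsCDF_zero {q : ℝ} (hq : 0 < q) {n j : ℕ} (hj : j ≤ n + 1) :
    mallowsCDF q (n + 1) 0 j = qInt q j / qInt q (n + 1) := by
  simp only [mallowsCDF, mallowsExp_succ, permInsert_zero, mallowsExp_const hq,
    sum_fin_ite_pow q hj]
  simp

lemma mallowsCDF_succ (q : ℝ) {n j : ℕ} (i : Fin n) (hj : j ≤ n) :
    mallowsCDF q (n + 1) i.succ (j + 1)
      = (qInt q (j + 1) * mallowsCDF q n i j
          + (qInt q (n + 1) - qInt q (j + 1)) * mallowsCDF q n i (j + 1)) / qInt q (n + 1) := by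
  rw [← sum_fin_ite_pow q (Nat.succ_le_succ hj), mallowsCDF, mallowsExp_succ]
  congr 1
  refine Finset.sum_congr rfl fun k _ => ?_
  congr 1
  have key : ∀ m : Fin n, ((k.succAbove m : ℕ) < j + 1)
      ↔ (m : ℕ) < if (k : ℕ) < j + 1 then j else j + 1 := by
    intro m
    simp only [Fin.succAbove, Fin.lt_def, Fin.val_castSucc]
    split_ifs <;> simp <;> omega
  simp only [permInsert_succ, key]
  split_ifs <;> rfl

/-- The discrete analogue of the limiting distribution function. -/
noncomputable def approxCDF (q : ℝ) (n i j : ℕ) : ℝ :=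
  q ^ i * qInt q j / (qInt q n - (1 - q) * qInt q i * qInt q j)

lemma qInt_bounds {q c C : ℝ} {n : ℕ} (h : ∀ k ≤ n, c ≤ q ^ k ∧ q ^ k ≤ C) :
    c * n ≤ qInt q n ∧ qInt q n ≤ C * n := by
  constructor
  · have := Finset.card_nsmul_le_sum (Finset.range n) (fun k => q ^ k) c
      (fun k hk => (h k (Finset.mem_range.1 hk).le).1)
    simpa [qInt, mul_comm] using this
  · have := Finset.sum_le_card_nsmul (Finset.range n) (fun k => q ^ k) C
      (fun k hk => (h k (Finset.mem_range.1 hk).le).2)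
    simpa [qInt, mul_comm] using this

lemma approxCDF_denom_lower {q c C : ℝ} {n i j : ℕ} (hq : 0 < q) (hc : 0 < c) (hc1 : c ≤ 1)
    (h : ∀ k ≤ n, c ≤ q ^ k ∧ q ^ k ≤ C) (hi : i ≤ n) (hj : j ≤ n) :
    c ^ 2 * n ≤ qInt q n - (1 - q) * qInt q i * qInt q j := by
  rw [one_sub_mul_qInt]
  have h1 := (h i hi).1
  have h2 := qInt_mono hq hj
  have h3 := qInt_nonneg hq j
  have h4 := (qInt_bounds h).1
  nlinarith [mul_le_mul_of_nonneg_right h1 h3, mul_le_mul_of_nonneg_left h4 hc.le,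
    mul_nonneg (sub_nonneg.2 hc1) (sub_nonneg.2 h2)]

/-- The defect of `approxCDF` in the recursion satisfied by `mallowsCDF`. -/
lemma approxCDF_defect_eq {q : ℝ} {n i j : ℕ}
    (h1 : qInt q (n + 1) ≠ 0)
    (h2 : qInt q (n + 1) - (1 - q) * qInt q (i + 1) * qInt q (j + 1) ≠ 0)
    (h3 : qInt q n - (1 - q) * qInt q i * qInt q j ≠ 0)
    (h4 : qInt q n - (1 - q) * qInt q i * qInt q (j + 1) ≠ 0) :
    approxCDF q (n + 1) (i + 1) (j + 1)
      - (qInt q (j + 1) * approxCDF q n i j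
          + (qInt q (n + 1) - qInt q (j + 1)) * approxCDF q n i (j + 1)) / qInt q (n + 1)
    = q ^ i * q ^ j * q * (1 - q) * qInt q (j + 1)
        * ((qInt q n - (1 - q) * qInt q i * qInt q j)
            * (qInt q n - qInt q j - qInt q i + (1 - q) * qInt q i * qInt q j)
          + qInt q i * qInt q j * q ^ i * q ^ j)
      / (qInt q (n + 1) * (qInt q (n + 1) - (1 - q) * qInt q (i + 1) * qInt q (j + 1))
        * (qInt q n - (1 - q) * qInt q i * qInt q j)
        * (qInt q n - (1 - q) * qInt q i * qInt q (j + 1))) := by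
  have hI : q ^ i = 1 - (1 - q) * qInt q i := by rw [one_sub_mul_qInt]; ring
  have hJ : q ^ j = 1 - (1 - q) * qInt q j := by rw [one_sub_mul_qInt]; ring
  unfold approxCDF
  rw [pow_succ, hI, hJ]
  simp only [qInt_succ] at *
  generalize qInt q n = N at *
  generalize qInt q i = A at *
  generalize qInt q j = B at *
  generalize hD2 : 1 + q * N - (1 - q) * (1 + q * A) * (1 + q * B) = D2 at *
  generalize hD3 : N - (1 - q) * A * B = D3 at *
  generalize hD4 : N - (1 - q) * A * (1 + q * B) = D4 at *
  generalize hD1 : 1 + q * N = D1 at *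
  field_simp
  rw [← hD1] at hD2 ⊢
  rw [← hD2, ← hD3, ← hD4]
  ring

lemma approxCDF_defect_le {q c C : ℝ} {n i j : ℕ} (hq : 0 < q) (hc : 0 < c) (hc1 : c ≤ 1)
    (hC1 : 1 ≤ C) (h : ∀ k ≤ n + 1, c ≤ q ^ k ∧ q ^ k ≤ C) (hi : i < n) (hj : j < n) :
    |approxCDF q (n + 1) (i + 1) (j + 1)
      - (qInt q (j + 1) * approxCDF q n i j
          + (qInt q (n + 1) - qInt q (j + 1)) * approxCDF q n i (j + 1)) / qInt q (n + 1)|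
      ≤ 9 * C ^ 8 / c ^ 7 * |1 - q| * (n : ℝ)⁻¹ := by
  have h' : ∀ k ≤ n, c ≤ q ^ k ∧ q ^ k ≤ C := fun k hk => h k (by omega)
  have hn : (0 : ℝ) < n := by exact_mod_cast (by omega : 0 < n)
  have d1 : c * n ≤ qInt q (n + 1) := (qInt_bounds h').1.trans (qInt_mono hq (Nat.le_succ n))
  have d2 : c ^ 2 * n ≤ qInt q (n + 1) - (1 - q) * qInt q (i + 1) * qInt q (j + 1) := by
    refine le_trans ?_ (approxCDF_denom_lower hq hc hc1 h (by omega) (by omega))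
    push_cast
    nlinarith [sq_nonneg c]
  have d3 := approxCDF_denom_lower hq hc hc1 h' hi.le hj.le
  have d4 := approxCDF_denom_lower hq hc hc1 h' hi.le hj
  have p1 : 0 < c * n := by positivity
  have p2 : 0 < c ^ 2 * n := by positivity
  rw [approxCDF_defect_eq (p1.trans_le d1).ne' (p2.trans_le d2).ne' (p2.trans_le d3).ne'
    (p2.trans_le d4).ne', abs_div]
  have hden : c ^ 7 * (n : ℝ) ^ 4 ≤
      qInt q (n + 1) * (qInt q (n + 1) - (1 - q) * qInt q (i + 1) * qInt q (j + 1))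
        * (qInt q n - (1 - q) * qInt q i * qInt q j)
        * (qInt q n - (1 - q) * qInt q i * qInt q (j + 1)) := by
    calc c ^ 7 * (n : ℝ) ^ 4 = (c * n) * (c ^ 2 * n) * (c ^ 2 * n) * (c ^ 2 * n) := by ring
      _ ≤ _ := by
        have g1 := p1.le.trans d1
        have g2 := p2.le.trans d2
        have g3 := p2.le.trans d3
        exact mul_le_mul (mul_le_mul (mul_le_mul d1 d2 p2.le g1) d3 p2.le (mul_nonneg g1 g2))
          d4 p2.le (mul_nonneg (mul_nonneg g1 g2) g3)
  have hN := qInt_nonneg hq n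
  have hA := qInt_nonneg hq i
  have hB := qInt_nonneg hq j
  have uN : qInt q n ≤ C * n := (qInt_bounds h').2
  have uA : qInt q i ≤ C * n := (qInt_mono hq hi.le).trans uN
  have uB : qInt q j ≤ C * n := (qInt_mono hq hj.le).trans uN
  have ub : qInt q (j + 1) ≤ C * n := (qInt_mono hq hj).trans uN
  have hI := h' i hi.le
  have hJ := h' j hj.le
  have hQ : q ≤ C := by simpa using (h' 1 (by omega)).2
  have hI0 : 0 < q ^ i := by positivity
  have hJ0 : 0 < q ^ j := by positivity
  have hIa : |(1 - q) * qInt q i| ≤ C := by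
    rw [one_sub_mul_qInt, abs_le]
    constructor <;> linarith
  have hAB : |(1 - q) * qInt q i * qInt q j| ≤ C * (C * n) := by
    rw [abs_mul, abs_of_nonneg hB]
    gcongr
  have hCn : C * n ≤ C * (C * n) := le_mul_of_one_le_left (by positivity) hC1
  have e1 : |qInt q n - (1 - q) * qInt q i * qInt q j| ≤ 2 * (C * (C * n)) := by
    rw [abs_le] at hAB ⊢
    constructor <;> linarith
  have e2 : |qInt q n - qInt q j - qInt q i + (1 - q) * qInt q i * qInt q j|
      ≤ 4 * (C * (C * n)) := by
    rw [abs_le] at hAB ⊢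
    constructor <;> linarith
  have e3 : |qInt q i * qInt q j * q ^ i * q ^ j| ≤ C * n * (C * n) * C * C := by
    rw [abs_of_nonneg (by positivity)]
    gcongr
    · exact hI.2
    · exact hJ.2
  have e4 : |(qInt q n - (1 - q) * qInt q i * qInt q j)
            * (qInt q n - qInt q j - qInt q i + (1 - q) * qInt q i * qInt q j)
          + qInt q i * qInt q j * q ^ i * q ^ j| ≤ 9 * C ^ 4 * n ^ 2 := by
    calc _ ≤ |qInt q n - (1 - q) * qInt q i * qInt q j|
            * |qInt q n - qInt q j - qInt q i + (1 - q) * qInt q i * qInt q j|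
          + |qInt q i * qInt q j * q ^ i * q ^ j| := by
          rw [← abs_mul]; exact abs_add_le _ _
      _ ≤ (2 * (C * (C * n))) * (4 * (C * (C * n))) + C * n * (C * n) * C * C := by gcongr
      _ = _ := by ring
  have hb := qInt_nonneg hq (j + 1)
  have hnum : |q ^ i * q ^ j * q * (1 - q) * qInt q (j + 1)
        * ((qInt q n - (1 - q) * qInt q i * qInt q j)
            * (qInt q n - qInt q j - qInt q i + (1 - q) * qInt q i * qInt q j)
          + qInt q i * qInt q j * q ^ i * q ^ j)|
      ≤ C * C * C * |1 - q| * (C * n) * (9 * C ^ 4 * n ^ 2) := by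
    rw [abs_mul, abs_mul, abs_mul, abs_of_pos (by positivity : 0 < q ^ i * q ^ j * q),
      abs_of_nonneg hb]
    gcongr
    · exact hI.2
    · exact hJ.2
  refine (div_le_div₀ (by positivity) hnum (by positivity) (hden.trans (le_abs_self _))).trans ?_
  apply le_of_eq
  field_simp

lemma approxCDF_of_eq {q : ℝ} (hq : 0 < q) (n i : ℕ) :
    approxCDF q (n + 1) i (n + 1) = 1 := by
  have h : qInt q (n + 1) - (1 - q) * qInt q i * qInt q (n + 1) = q ^ i * qInt q (n + 1) := by
    rw [one_sub_mul_qInt]; ring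
  have := qInt_pos hq n
  rw [approxCDF, h, div_self (by positivity)]

/-- The Mallows distribution functions are close to their explicit approximations. -/
lemma abs_mallowsCDF_sub_approxCDF_le {q c C : ℝ} (hq : 0 < q) (hc : 0 < c) (hc1 : c ≤ 1)
    (hC1 : 1 ≤ C) {n : ℕ} (h : ∀ k ≤ n, c ≤ q ^ k ∧ q ^ k ≤ C) (i : Fin n) {j : ℕ} (hj : j ≤ n) :
    |mallowsCDF q n i j - approxCDF q n i j|
      ≤ 9 * C ^ 8 / c ^ 7 * |1 - q| * ∑ k ∈ Finset.range n, (k : ℝ)⁻¹ := by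
  have hS : ∀ m : ℕ, 0 ≤ 9 * C ^ 8 / c ^ 7 * |1 - q| * ∑ k ∈ Finset.range m, (k : ℝ)⁻¹ := by
    intro m
    have : 0 ≤ ∑ k ∈ Finset.range m, (k : ℝ)⁻¹ := Finset.sum_nonneg fun _ _ => by positivity
    positivity
  induction n generalizing j with
  | zero => exact i.elim0
  | succ n ih =>
    rcases j with _ | j
    · rw [mallowsCDF_zero_right hq]
      simpa [approxCDF, qInt_zero] using hS (n + 1)
    induction i using Fin.cases with
    | zero =>
      rw [mallowsCDF_zero hq hj]
      simpa [approxCDF, qInt_zero] using hS (n + 1)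
    | succ i =>
      rcases Nat.lt_or_ge j n with hjn | hjn
      · rw [mallowsCDF_succ q i hjn.le, Finset.sum_range_succ, mul_add]
        have h' : ∀ k ≤ n, c ≤ q ^ k ∧ q ^ k ≤ C := fun k hk => h k (by omega)
        have a1 := ih h' i hjn.le
        have a2 := ih h' i (Nat.succ_le_of_lt hjn)
        have a3 := approxCDF_defect_le hq hc hc1 hC1 h i.is_lt hjn
        rw [Fin.val_succ]
        set E := 9 * C ^ 8 / c ^ 7 * |1 - q| * ∑ k ∈ Finset.range n, (k : ℝ)⁻¹
        have hN := qInt_pos hq n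
        have hb := qInt_nonneg hq (j + 1)
        have hbN := sub_nonneg.2 (qInt_mono hq hj)
        have a4 : |(qInt q (j + 1) * mallowsCDF q n i j
              + (qInt q (n + 1) - qInt q (j + 1)) * mallowsCDF q n i (j + 1)) / qInt q (n + 1)
            - (qInt q (j + 1) * approxCDF q n i j
              + (qInt q (n + 1) - qInt q (j + 1)) * approxCDF q n i (j + 1)) / qInt q (n + 1)|
            ≤ E := by
          rw [← sub_div, abs_div, abs_of_pos hN, div_le_iff₀ hN]
          rw [abs_le] at a1 a2 ⊢
          constructor <;> nlinarith
        rw [abs_le] at a3 a4 ⊢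
        constructor <;> linarith
      · obtain rfl : j = n := by omega
        rw [mallowsCDF_of_le hq _ le_rfl, approxCDF_of_eq hq]
        simpa using hS (j + 1)

/-- The limit of the rescaled `q`-integers, equal to `∫₀ˢ exp (-β r) dr`. -/
noncomputable def limitInt (β s : ℝ) : ℝ :=
  if β = 0 then s else (1 - Real.exp (-(β * s))) / β

/-- The limiting distribution function. -/
noncomputable def limitCDF (β x y : ℝ) : ℝ :=
  Real.exp (-(β * x)) * limitInt β y / (limitInt β 1 - β * limitInt β x * limitInt β y)

lemma limitInt_zero (β : ℝ) : limitInt β 0 = 0 := by simp [limitInt]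

lemma mul_limitInt (β s : ℝ) : β * limitInt β s = 1 - Real.exp (-(β * s)) := by
  unfold limitInt
  split_ifs with h
  · simp [h]
  · field_simp

lemma hasDerivAt_limitInt (β s : ℝ) : HasDerivAt (limitInt β) (Real.exp (-(β * s))) s := by
  unfold limitInt
  split_ifs with h
  · simpa [h] using hasDerivAt_id' s
  · have h1 : HasDerivAt (fun s : ℝ => -(β * s)) (-β) s := by
      simpa using (hasDerivAt_id' s).const_mul (-β)
    refine ((h1.exp.const_sub 1).div_const β).congr_deriv ?_
    rw [← mul_neg, neg_neg, mul_div_cancel_right₀ _ h]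

lemma limitInt_strictMono (β : ℝ) : StrictMono (limitInt β) :=
  strictMono_of_hasDerivAt_pos (hasDerivAt_limitInt β) fun _ => Real.exp_pos _

lemma limitCDF_denom_pos (β x : ℝ) {y : ℝ} (hy : y ∈ Set.Icc (0 : ℝ) 1) :
    0 < limitInt β 1 - β * limitInt β x * limitInt β y := by
  have h : limitInt β 1 - β * limitInt β x * limitInt β y
      = (limitInt β 1 - limitInt β y) + Real.exp (-(β * x)) * limitInt β y := by
    rw [mul_limitInt]; ring
  have h0 : 0 ≤ limitInt β y := by
    simpa [limitInt_zero] using (limitInt_strictMono β).monotone hy.1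
  rcases hy.2.lt_or_eq with h1 | rfl
  · have := limitInt_strictMono β h1
    have := mul_nonneg (Real.exp_pos (-(β * x))).le h0
    linarith
  · have : 0 < limitInt β 1 := by
      simpa [limitInt_zero] using limitInt_strictMono β (zero_lt_one' ℝ)
    rw [h, sub_self, zero_add]
    positivity

lemma limitCDF_zero (β x : ℝ) : limitCDF β x 0 = 0 := by simp [limitCDF, limitInt_zero]

lemma limitCDF_one (β x : ℝ) : limitCDF β x 1 = 1 := by
  have h : limitInt β 1 - β * limitInt β x * limitInt β 1
      = Real.exp (-(β * x)) * limitInt β 1 := by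
    rw [mul_limitInt]; ring
  have hp := limitCDF_denom_pos β x (y := 1) (by simp)
  rw [limitCDF, h, div_self]
  rw [← h]
  exact hp.ne'

lemma hasDerivAt_limitCDF (β x : ℝ) {y : ℝ} (hy : y ∈ Set.Icc (0 : ℝ) 1) :
    HasDerivAt (limitCDF β x)
      (Real.exp (-(β * x)) * Real.exp (-(β * y)) * limitInt β 1
        / (limitInt β 1 - β * limitInt β x * limitInt β y) ^ 2) y := by
  have hB := hasDerivAt_limitInt β y
  refine ((hB.const_mul (Real.exp (-(β * x)))).div
    ((hB.const_mul (β * limitInt β x)).const_sub (limitInt β 1))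
    (limitCDF_denom_pos β x hy).ne').congr_deriv ?_
  ring

lemma mallowsU_eq (β x : ℝ) {y : ℝ} (hy : y ∈ Set.Icc (0 : ℝ) 1) :
    mallowsU x y β = Real.exp (-(β * x)) * Real.exp (-(β * y)) * limitInt β 1
        / (limitInt β 1 - β * limitInt β x * limitInt β y) ^ 2 := by
  by_cases hβ : β = 0
  · simp [mallowsU, limitInt, hβ]
  have hD := (limitCDF_denom_pos β x hy).ne'
  simp only [limitInt, hβ, if_false] at hD ⊢
  rw [mallowsU, if_neg hβ, Real.cosh_eq, Real.cosh_eq, Real.sinh_eq]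
  obtain ⟨g, hg⟩ : ∃ g, g = Real.exp (β / 4) := ⟨_, rfl⟩
  obtain ⟨X, hX⟩ : ∃ X, X = Real.exp (-(β * x) / 2) := ⟨_, rfl⟩
  obtain ⟨Y, hY⟩ : ∃ Y, Y = Real.exp (-(β * y) / 2) := ⟨_, rfl⟩
  have g0 : g ≠ 0 := by rw [hg]; positivity
  have X0 : X ≠ 0 := by rw [hX]; positivity
  have Y0 : Y ≠ 0 := by rw [hY]; positivity
  have e1 : Real.exp (-β / 4) = g⁻¹ := by rw [hg, ← Real.exp_neg]; ring_nf
  have e2 : Real.exp (β / 2) = g * g := by rw [hg, ← Real.exp_add]; ring_nf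
  have e3 : Real.exp (-(β / 2)) = g⁻¹ * g⁻¹ := by
    rw [hg, ← Real.exp_neg, ← Real.exp_add]; ring_nf
  have e4 : Real.exp (-(β * x)) = X * X := by rw [hX, ← Real.exp_add]; ring_nf
  have e5 : Real.exp (-(β * y)) = Y * Y := by rw [hY, ← Real.exp_add]; ring_nf
  have e6 : Real.exp (-(β * 1)) = (g⁻¹ * g⁻¹) * (g⁻¹ * g⁻¹) := by
    rw [← e3, ← Real.exp_add]; ring_nf
  have e7 : Real.exp (β * (x - y) / 2) = X⁻¹ * Y := by
    rw [hX, hY, ← Real.exp_neg, ← Real.exp_add]; ring_nf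
  have e8 : Real.exp (-(β * (x - y) / 2)) = X * Y⁻¹ := by
    rw [hX, hY, ← Real.exp_neg, ← Real.exp_add]; ring_nf
  have e9 : Real.exp (β * (x + y - 1) / 2) = X⁻¹ * Y⁻¹ * (g⁻¹ * g⁻¹) := by
    rw [← e3, hX, hY, ← Real.exp_neg, ← Real.exp_neg, ← Real.exp_add, ← Real.exp_add]; ring_nf
  have e10 : Real.exp (-(β * (x + y - 1) / 2)) = X * Y * (g * g) := by
    rw [← e2, hX, hY, ← Real.exp_add, ← Real.exp_add]; ring_nf
  rw [e4, e5, e6] at hD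
  rw [← hg, e1, e2, e3, e4, e5, e6, e7, e8, e9, e10]
  obtain ⟨Δ, hΔ⟩ : ∃ Δ, Δ = X ^ 2 + Y ^ 2 - X ^ 2 * Y ^ 2 - (g⁻¹) ^ 4 := ⟨_, rfl⟩
  have d1 : (1 - g⁻¹ * g⁻¹ * (g⁻¹ * g⁻¹)) / β - β * ((1 - X * X) / β) * ((1 - Y * Y) / β)
      = Δ / β := by
    rw [hΔ]; field_simp; ring
  have d2 : g * ((X⁻¹ * Y + X * Y⁻¹) / 2)
      - g⁻¹ * ((X⁻¹ * Y⁻¹ * (g⁻¹ * g⁻¹) + X * Y * (g * g)) / 2) = g * Δ / (2 * X * Y) := by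
    rw [hΔ]; field_simp; ring
  have Δ0 : Δ ≠ 0 := by
    rw [d1] at hD
    exact fun h => hD (by simp [h])
  rw [d1, d2]
  field_simp

lemma integral_mallowsU (β x : ℝ) {y : ℝ} (hy : y ∈ Set.Icc (0 : ℝ) 1) :
    ∫ s in (0 : ℝ)..y, mallowsU x s β = limitCDF β x y := by
  have hsub : ∀ s ∈ Set.uIcc 0 y, s ∈ Set.Icc (0 : ℝ) 1 := by
    intro s hs
    rw [Set.uIcc_of_le hy.1] at hs
    exact ⟨hs.1, hs.2.trans hy.2⟩
  rw [intervalIntegral.integral_congr fun s hs => mallowsU_eq β x (hsub s hs),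
    intervalIntegral.integral_eq_sub_of_hasDerivAt
      (fun s hs => hasDerivAt_limitCDF β x (hsub s hs)), limitCDF_zero, sub_zero]
  have hc : Continuous (limitInt β) :=
    continuous_iff_continuousAt.2 fun s => (hasDerivAt_limitInt β s).continuousAt
  refine ContinuousOn.intervalIntegrable (ContinuousOn.div (by fun_prop) (by fun_prop) ?_)
  exact fun s hs => pow_ne_zero _ (limitCDF_denom_pos β x (hsub s hs)).ne'

section Asymptotics

variable {q : ℕ → ℝ} {β : ℝ}

lemma tendsto_pow_exp (hq : ∀ n, 0 < q n)
    (hβ : Tendsto (fun n : ℕ => (n : ℝ) * (1 - q n)) atTop (nhds β))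
    {k : ℕ → ℕ} {s : ℝ} (hk : Tendsto (fun n : ℕ => (k n : ℝ) / n) atTop (nhds s))
    (hkn : ∀ n, k n ≤ n) :
    Tendsto (fun n => q n ^ k n) atTop (nhds (Real.exp (-(β * s)))) := by
  have h1 : Tendsto (fun n : ℕ => (1 + -(1 - q n)) ^ n) atTop (nhds (Real.exp (-β))) := by
    apply Real.tendsto_one_add_pow_exp_of_tendsto
    simpa only [mul_neg] using hβ.neg
  have h2 : Tendsto (fun n : ℕ => (n : ℝ) * Real.log (q n)) atTop (nhds (-β)) := by
    have := h1.log (Real.exp_pos _).ne'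
    simpa [Real.log_pow] using this
  have h3 := (hk.mul h2).rexp
  rw [show s * -β = -(β * s) by ring] at h3
  refine h3.congr fun n => ?_
  rcases Nat.eq_zero_or_pos n with rfl | hn
  · have := hkn 0
    simp [Nat.le_zero.1 this]
  · have hn' : (n : ℝ) ≠ 0 := by positivity
    rw [show (k n : ℝ) / n * (n * Real.log (q n)) = k n * Real.log (q n) by field_simp,
      Real.exp_nat_mul, Real.exp_log (hq n)]

lemma pow_mem_Icc_min_max {p : ℝ} (hp : 0 < p) {k n : ℕ} (hk : k ≤ n) :
    min 1 (p ^ n) ≤ p ^ k ∧ p ^ k ≤ max 1 (p ^ n) := by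
  rcases le_total p 1 with h | h
  · exact ⟨(min_le_right _ _).trans (pow_le_pow_of_le_one hp.le h hk),
      (pow_le_one₀ hp.le h).trans (le_max_left _ _)⟩
  · exact ⟨(min_le_left _ _).trans (one_le_pow₀ h),
      (pow_le_pow_right₀ h hk).trans (le_max_right _ _)⟩

lemma tendsto_natCast_div_self :
    Tendsto (fun n : ℕ => ((n : ℕ) : ℝ) / n) atTop (nhds 1) := by
  refine tendsto_const_nhds.congr' ?_
  filter_upwards [eventually_gt_atTop 0] with n hn
  rw [div_self (by positivity)]

lemma tendsto_qInt_div (hq : ∀ n, 0 < q n)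
    (hβ : Tendsto (fun n : ℕ => (n : ℝ) * (1 - q n)) atTop (nhds β))
    {k : ℕ → ℕ} {s : ℝ} (hk : Tendsto (fun n : ℕ => (k n : ℝ) / n) atTop (nhds s))
    (hkn : ∀ n, k n ≤ n) :
    Tendsto (fun n => qInt (q n) (k n) / n) atTop (nhds (limitInt β s)) := by
  unfold limitInt
  split_ifs with h
  · have hpow := tendsto_pow_exp hq hβ tendsto_natCast_div_self (fun n => le_rfl)
    simp only [h, zero_mul, neg_zero, Real.exp_zero] at hpow
    have hb : ∀ n, ∀ l ≤ k n, min 1 (q n ^ n) ≤ q n ^ l ∧ q n ^ l ≤ max 1 (q n ^ n) :=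
      fun n l hl => pow_mem_Icc_min_max (hq n) (hl.trans (hkn n))
    have lower := (tendsto_const_nhds (x := (1 : ℝ))).min hpow |>.mul hk
    have upper := (tendsto_const_nhds (x := (1 : ℝ))).max hpow |>.mul hk
    rw [min_self, one_mul] at lower
    rw [max_self, one_mul] at upper
    refine tendsto_of_tendsto_of_tendsto_of_le_of_le lower upper (fun n => ?_) (fun n => ?_)
    · change _ * ((k n : ℝ) / n) ≤ _
      rw [mul_div_assoc']
      exact div_le_div_of_nonneg_right (qInt_bounds (hb n)).1 (Nat.cast_nonneg n)
    · change _ ≤ _ * ((k n : ℝ) / n)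
      rw [mul_div_assoc']
      exact div_le_div_of_nonneg_right (qInt_bounds (hb n)).2 (Nat.cast_nonneg n)
  · refine (((tendsto_pow_exp hq hβ hk hkn).const_sub 1).div hβ h).congr' ?_
    filter_upwards [hβ.eventually_ne h, eventually_gt_atTop 0] with n hn hn0
    have h1 : 1 - q n ≠ 0 := right_ne_zero_of_mul hn
    have h2 : (n : ℝ) ≠ 0 := by positivity
    simp only [Pi.div_apply]
    rw [← one_sub_mul_qInt]
    field_simp

lemma tendsto_approxCDF (hq : ∀ n, 0 < q n)
    (hβ : Tendsto (fun n : ℕ => (n : ℝ) * (1 - q n)) atTop (nhds β))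
    {k l : ℕ → ℕ} {x y : ℝ} (hk : Tendsto (fun n : ℕ => (k n : ℝ) / n) atTop (nhds x))
    (hkn : ∀ n, k n ≤ n) (hl : Tendsto (fun n : ℕ => (l n : ℝ) / n) atTop (nhds y))
    (hln : ∀ n, l n ≤ n) (hy : y ∈ Set.Icc (0 : ℝ) 1) :
    Tendsto (fun n => approxCDF (q n) n (k n) (l n)) atTop (nhds (limitCDF β x y)) := by
  have hK := tendsto_qInt_div hq hβ hk hkn
  have hL := tendsto_qInt_div hq hβ hl hln
  have hN := tendsto_qInt_div hq hβ tendsto_natCast_div_self (fun n => le_rfl)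
  refine (((tendsto_pow_exp hq hβ hk hkn).mul hL).div (hN.sub ((hβ.mul hK).mul hL))
    (limitCDF_denom_pos β x hy).ne').congr' ?_
  filter_upwards [eventually_gt_atTop 0] with n hn
  have h2 : (n : ℝ) ≠ 0 := by positivity
  simp only [Pi.div_apply]
  rw [approxCDF, ← mul_div_mul_right _ _ h2]
  congr 1 <;> field_simp

lemma tendsto_harmonic_defect
    (hβ : Tendsto (fun n : ℕ => (n : ℝ) * (1 - q n)) atTop (nhds β)) (K : ℝ) :
    Tendsto (fun n : ℕ => K * |1 - q n| * ∑ k ∈ Finset.range n, (k : ℝ)⁻¹) atTop (nhds 0) := by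
  have h := (hβ.abs.mul (tendsto_inv_atTop_nhds_zero_nat (𝕜 := ℝ)).cesaro).const_mul K
  rw [mul_zero, mul_zero] at h
  refine h.congr' ?_
  filter_upwards [eventually_gt_atTop 0] with n hn
  have h2 : (0 : ℝ) < n := by positivity
  rw [abs_mul, abs_of_pos h2]
  field_simp

/-- The rescaled images of a sequence of points under Mallows permutations have distribution
functions converging to `limitCDF`. -/
lemma tendsto_mallowsExp_indicator (hq : ∀ n, 0 < q n)
    (hβ : Tendsto (fun n : ℕ => (n : ℝ) * (1 - q n)) atTop (nhds β))
    {a : ℕ → ℕ} (ha : ∀ n : ℕ, 1 ≤ n → 1 ≤ a n ∧ a n ≤ n) {x : ℝ}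
    (haa : Tendsto (fun n : ℕ => (a n : ℝ) / n) atTop (nhds x))
    {y : ℝ} (hy : y ∈ Set.Icc (0 : ℝ) 1) :
    Tendsto (fun n => mallowsExp n (q n)
      (fun π => (Set.Iic y).indicator 1 ((permAct n π (a n) : ℝ) / n)))
      atTop (nhds (limitCDF β x y)) := by
  have hl : Tendsto (fun n : ℕ => (⌊y * n⌋₊ : ℝ) / n) atTop (nhds y) :=
    (tendsto_nat_floor_mul_div_atTop hy.1).comp tendsto_natCast_atTop_atTop
  have hln : ∀ n : ℕ, ⌊y * n⌋₊ ≤ n := fun n =>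
    Nat.floor_le_of_le (mul_le_of_le_one_left (Nat.cast_nonneg n) hy.2)
  have hk : Tendsto (fun n : ℕ => ((min (a n - 1) n : ℕ) : ℝ) / n) atTop (nhds x) := by
    have h := haa.sub (tendsto_inv_atTop_nhds_zero_nat (𝕜 := ℝ))
    rw [sub_zero] at h
    refine h.congr' ?_
    filter_upwards [eventually_gt_atTop 0] with n hn
    have := ha n hn
    rw [min_eq_left (by omega), Nat.cast_sub this.1, Nat.cast_one, sub_div, one_div]
  have happ := tendsto_approxCDF hq hβ hk (fun n => min_le_right _ _) hl hln hy
  have hpow := tendsto_pow_exp hq hβ tendsto_natCast_div_self (fun n => le_rfl)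
  have hE := Real.exp_pos (-(β * 1))
  set E := Real.exp (-(β * 1))
  have hz := tendsto_harmonic_defect hβ (9 * (max 1 (2 * E)) ^ 8 / (min 1 (E / 2)) ^ 7)
  have hdiff := squeeze_zero_norm' (f := fun n => mallowsExp n (q n)
      (fun π => (Set.Iic y).indicator 1 ((permAct n π (a n) : ℝ) / n))
        - approxCDF (q n) n (min (a n - 1) n) ⌊y * n⌋₊) ?_ hz
  · simpa using hdiff.add happ
  filter_upwards [eventually_gt_atTop 0, hpow.eventually_const_le (by linarith : E / 2 < E),
    hpow.eventually_le_const (by linarith : E < 2 * E)] with n hn h1 h2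
  have han := ha n hn
  have hn' : (0 : ℝ) < n := by exact_mod_cast hn
  have hcdf : mallowsExp n (q n)
      (fun π => (Set.Iic y).indicator 1 ((permAct n π (a n) : ℝ) / n))
      = mallowsCDF (q n) n ⟨a n - 1, by omega⟩ ⌊y * n⌋₊ := by
    unfold mallowsCDF
    congr 1
    funext π
    rw [permAct, dif_pos han, Set.indicator_apply]
    refine if_congr ?_ rfl rfl
    rw [Set.mem_Iic, div_le_iff₀ hn', ← Nat.le_floor_iff (by have := hy.1; positivity)]
    exact Nat.succ_le_iff
  rw [hcdf, min_eq_left (by omega), Real.norm_eq_abs]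
  refine abs_mallowsCDF_sub_approxCDF_le (hq n) (by positivity) (min_le_left _ _)
    (le_max_left _ _) (fun k hk => ?_) ⟨a n - 1, by omega⟩ (hln n)
  have := pow_mem_Icc_min_max (hq n) hk
  exact ⟨(min_le_min_left 1 h1).trans this.1, this.2.trans (max_le_max_left 1 h2)⟩

end Asymptotics

/-- A continuous function interpolating between the indicators of `Iic y` and `Iic z`. -/
lemma exists_boundedContinuous_between {y z : ℝ} (h : y < z) :
    ∃ f : BoundedContinuousFunction ℝ ℝ, ∀ s,
      (Set.Iic y).indicator 1 s ≤ f s ∧ f s ≤ (Set.Iic z).indicator 1 s := by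
  have h' : 0 < z - y := sub_pos.2 h
  refine ⟨BoundedContinuousFunction.ofNormedAddCommGroup
    (fun s => max 0 (min 1 ((z - s) / (z - y)))) (by fun_prop) 1 ?_, fun s => ⟨?_, ?_⟩⟩
  · intro s
    rw [Real.norm_eq_abs, abs_of_nonneg (le_max_left _ _)]
    exact max_le zero_le_one (min_le_left _ _)
  · refine Set.indicator_apply_le' (fun hs => ?_) fun _ => le_max_left _ _
    refine le_max_of_le_right (le_min le_rfl ?_)
    rw [Pi.one_apply, le_div_iff₀ h']
    linarith [Set.mem_Iic.1 hs]
  · by_cases hs : s ≤ z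
    · rw [Set.indicator_of_mem (Set.mem_Iic.2 hs)]
      exact max_le zero_le_one (min_le_left _ _)
    · rw [Set.indicator_of_notMem (by simpa using hs)]
      refine max_le le_rfl ((min_le_right _ _).trans (div_nonpos_of_nonpos_of_nonneg ?_ h'.le))
      linarith

/-- **Lemma 3.11.** If `n(1-qₙ) → β`, `aₙ ∈ {1,…,n}` with `aₙ/n → a ∈ [0,1]`, and along a
subsequence `tₙ` the laws of `π(a_{tₙ})/tₙ` under `μ_{tₙ,q_{tₙ}}` converge in distribution
to a probability measure `v`, then the distribution function of `v` satisfies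
`F_v(y) = ∫₀^y u(a,s,β) ds` for all `y ∈ [0,1]`. -/
theorem limit_cdf_formula
    (q : ℕ → ℝ) (hq : ∀ n, 0 < q n) (β : ℝ)
    (hβ : Tendsto (fun n : ℕ => (n : ℝ) * (1 - q n)) atTop (nhds β))
    (a : ℕ → ℕ) (ha : ∀ n : ℕ, 1 ≤ n → 1 ≤ a n ∧ a n ≤ n)
    (av : ℝ) (hav : av ∈ Set.Icc (0 : ℝ) 1)
    (haa : Tendsto (fun n : ℕ => (a n : ℝ) / n) atTop (nhds av))
    (t : ℕ → ℕ) (hmono : StrictMono t)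
    (v : Measure ℝ) (hv : IsProbabilityMeasure v)
    (hconv : ∀ f : BoundedContinuousFunction ℝ ℝ,
      Tendsto (fun n : ℕ =>
          mallowsExp (t n) (q (t n))
            (fun π => f ((permAct (t n) π (a (t n)) : ℝ) / (t n))))
        atTop (nhds (∫ y, f y ∂v))) :
    ∀ y ∈ Set.Icc (0 : ℝ) 1,
      (v (Set.Iic y)).toReal = ∫ s in (0:ℝ)..y, mallowsU av s β := by
  have ht := hmono.tendsto_atTop
  have hlim : ∀ y ∈ Set.Icc (0 : ℝ) 1, _ := fun y hy =>
    (tendsto_mallowsExp_indicator hq hβ ha haa hy).comp ht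
  have hind : ∀ y, ∫ s, (Set.Iic y).indicator 1 s ∂v = v.real (Set.Iic y) := fun y =>
    integral_indicator_one measurableSet_Iic
  have hint : ∀ y, Integrable ((Set.Iic y).indicator (1 : ℝ → ℝ)) v := fun y =>
    (integrable_const (1 : ℝ)).indicator measurableSet_Iic
  have upper : ∀ y, ∀ z ∈ Set.Icc (0 : ℝ) 1, y < z →
      v.real (Set.Iic y) ≤ limitCDF β av z := by
    intro y z hz hyz
    obtain ⟨f, hf⟩ := exists_boundedContinuous_between hyz
    rw [← hind]
    exact (integral_mono (hint y) (f.integrable v) fun s => (hf s).1).trans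
      (le_of_tendsto_of_tendsto' (hconv f) (hlim z hz)
        fun n => mallowsExp_mono (hq _) fun π => (hf _).2)
  have lower : ∀ y ∈ Set.Icc (0 : ℝ) 1, ∀ z, y < z →
      limitCDF β av y ≤ v.real (Set.Iic z) := by
    intro y hy z hyz
    obtain ⟨f, hf⟩ := exists_boundedContinuous_between hyz
    rw [← hind]
    exact (le_of_tendsto_of_tendsto' (hlim y hy) (hconv f)
        fun n => mallowsExp_mono (hq _) fun π => (hf _).1).trans
      (integral_mono (f.integrable v) (hint z) fun s => (hf s).2)
  intro y hy
  rw [integral_mallowsU β av hy]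
  have hcont := (hasDerivAt_limitCDF β av hy).continuousAt.tendsto
  apply le_antisymm
  · rcases hy.2.lt_or_eq with h1 | rfl
    · refine ge_of_tendsto (hcont.mono_left (nhdsWithin_le_nhds (s := Set.Ioi y))) ?_
      filter_upwards [Ioo_mem_nhdsGT h1] with z hz
      exact upper y z ⟨hy.1.trans hz.1.le, hz.2.le⟩ hz.1
    · rw [limitCDF_one]
      exact measureReal_le_one
  · rcases hy.1.lt_or_eq with h0 | rfl
    · refine le_of_tendsto (hcont.mono_left (nhdsWithin_le_nhds (s := Set.Iio y))) ?_
      filter_upwards [Ioo_mem_nhdsLT h0] with z hz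
      exact lower z ⟨hz.1.le, hz.2.le.trans hy.2⟩ y hz.2
    · rw [limitCDF_zero]
      exact measureReal_nonneg
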